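/- arXiv:2204.03845 — 2 statements merged into one kernel-verified Lean document; each statement's English description precedes it below -/
import Mathlib

section
/- (Equation (12): per-example surrogate bound on the MAP loss.) Let c ≥ 1, let S ⊆ Y = {1,...,c} be nonempty, let θ ∈ (0,1]^c, z ∈ (0,1)^c and λ, α, β ∈ ℝ^c. Define w_j = λ_j − 1 + 1/|S| for j ∈ S and w_j = λ_j − 1 for j ∉ S, and define K_S = log|S| + (1/|S|)·∑_{j∈S} log P_j + ∑_{j=1}^c [(α_j−1)·log z_j + (β_j−1)·log(1−z_j)]. Then L_MAP(θ,z) ≤ −K_S + ∑_{j=1}^c w_j·(−log θ_j). -/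
open Finset

variable {c : ℕ}

/-- For each `j ∈ S`, the product `P_j = ∏_{k∈S\{j}} z_k · ∏_{k∈Y\(S\{j})} (1−z_k)`. -/
def Pprod (S : Finset (Fin c)) (z : Fin c → ℝ) (j : Fin c) : ℝ :=
  (∏ k ∈ S.erase j, z k) * ∏ k ∈ (S.erase j)ᶜ, (1 - z k)

/-- The per-example MAP loss
`L_MAP(θ,z) = −log(∑_{j∈S} θ_j·P_j) − ∑_{j=1}^c [(λ_j−1)·log θ_j + (α_j−1)·log z_j + (β_j−1)·log(1−z_j)]`. -/
noncomputable def Lmap (S : Finset (Fin c)) (lam al be θ z : Fin c → ℝ) : ℝ :=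
  -Real.log (∑ j ∈ S, θ j * Pprod S z j) -
    ∑ j : Fin c, ((lam j - 1) * Real.log (θ j) + (al j - 1) * Real.log (z j) +
      (be j - 1) * Real.log (1 - z j))

theorem Pprod_pos (S : Finset (Fin c)) {z : Fin c → ℝ} (hz : ∀ j, z j ∈ Set.Ioo (0 : ℝ) 1)
    (j : Fin c) : 0 < Pprod S z j :=
  mul_pos (prod_pos fun k _ => (hz k).1) (prod_pos fun k _ => sub_pos.2 (hz k).2)

/-- Jensen's inequality for the logarithm with uniform weights. -/
theorem log_card_add_mean_log_le_log_sum {ι : Type*} {s : Finset ι} (hs : s.Nonempty)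
    {x : ι → ℝ} (hx : ∀ i ∈ s, 0 < x i) :
    Real.log (s.card : ℝ) + (s.card : ℝ)⁻¹ * ∑ i ∈ s, Real.log (x i) ≤
      Real.log (∑ i ∈ s, x i) := by
  have hcard : (s.card : ℝ) ≠ 0 := Nat.cast_ne_zero.2 hs.card_ne_zero
  have jensen := strictConcaveOn_log_Ioi.concaveOn.le_map_sum (t := s)
    (w := fun _ => (s.card : ℝ)⁻¹) (p := x) (fun _ _ => by positivity)
    (by simp [hcard]) hx
  simp only [smul_eq_mul, ← mul_sum] at jensen
  rw [Real.log_mul (inv_ne_zero hcard) (sum_pos hx hs).ne', Real.log_inv] at jensen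
  linarith

/-- **Equation (12): per-example surrogate bound on the MAP loss.**
Let `c ≥ 1`, `S ⊆ {1,...,c}` nonempty, `θ ∈ (0,1]^c`, `z ∈ (0,1)^c`, `λ, α, β ∈ ℝ^c`.
With `w_j = λ_j − 1 + 1/|S|` for `j ∈ S`, `w_j = λ_j − 1` otherwise, and
`K_S = log|S| + (1/|S|)·∑_{j∈S} log P_j + ∑_j [(α_j−1)·log z_j + (β_j−1)·log(1−z_j)]`,
we have `L_MAP(θ,z) ≤ −K_S + ∑_j w_j·(−log θ_j)`. -/
theorem statement5 (hc : 1 ≤ c) (S : Finset (Fin c)) (hS : S.Nonempty)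
    (θ z lam al be : Fin c → ℝ)
    (hθ : ∀ j, θ j ∈ Set.Ioc (0 : ℝ) 1) (hz : ∀ j, z j ∈ Set.Ioo (0 : ℝ) 1) :
    Lmap S lam al be θ z ≤
      -(Real.log (S.card : ℝ) + (S.card : ℝ)⁻¹ * ∑ j ∈ S, Real.log (Pprod S z j) +
          ∑ j : Fin c, ((al j - 1) * Real.log (z j) + (be j - 1) * Real.log (1 - z j))) +
        ∑ j : Fin c,
          (if j ∈ S then lam j - 1 + (S.card : ℝ)⁻¹ else lam j - 1) * (-Real.log (θ j)) := by
  have hP := Pprod_pos S hz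
  have jensen := log_card_add_mean_log_le_log_sum hS
    (fun j _ => mul_pos (hθ j).1 (hP j))
  have hlog : ∑ j ∈ S, Real.log (θ j * Pprod S z j) =
      ∑ j ∈ S, Real.log (θ j) + ∑ j ∈ S, Real.log (Pprod S z j) := by
    rw [← sum_add_distrib]
    exact sum_congr rfl fun j _ => Real.log_mul (hθ j).1.ne' (hP j).ne'
  have hw : ∑ j : Fin c,
      (if j ∈ S then lam j - 1 + (S.card : ℝ)⁻¹ else lam j - 1) * (-Real.log (θ j)) =
      -(∑ j : Fin c, (lam j - 1) * Real.log (θ j)) -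
        (S.card : ℝ)⁻¹ * ∑ j ∈ S, Real.log (θ j) := by
    rw [← sum_neg_distrib, mul_sum, ← univ_inter S, ← sum_ite_mem, univ_inter, ← sum_sub_distrib]
    refine sum_congr rfl fun j _ => ?_
    split_ifs <;> ring
  rw [hlog, mul_add] at jensen
  rw [Lmap, hw]
  simp only [add_assoc, sum_add_distrib] at *
  linarith
end

section
/- (Boundedness of the MAP loss, Appendix A.5.) Let c ≥ 1, a ≥ 1, b ≥ 0, γ > 0, A > 0, set U₋ = a·exp(−A/γ)+b, U₊ = a·exp(A/γ)+b, B = U₋/(c·U₊ + c), E = U₋/(2·U₊+1), F = (U₊+1)/(U₊+U₋+1). Let S ⊆ Y = {1,...,c} be nonempty, and suppose θ ∈ ℝ^c with B ≤ θ_j ≤ 1 for all j, z ∈ ℝ^c with E ≤ z_j ≤ F for all j, and λ, α, β ∈ ℝ^c with λ_j ≤ U₊, α_j ≤ U₊, β_j ≤ U₊ for all j. Then L_MAP(θ,z) ≤ −log( |S| · B · E^{|S|−1} · (1−F)^{c+1−|S|} ) − c·U₊·log( B·E·(1−F) ). -/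
open Finset

variable {c : ℕ}

/-- Lower bound for the product `P_j` when every `z_k` lies in `[E, F]` with `0 ≤ E` and `F ≤ 1`. -/
theorem le_Pprod {S : Finset (Fin c)} {z : Fin c → ℝ} {E F : ℝ} (hE : 0 ≤ E) (hF : F ≤ 1)
    (hz : ∀ j, E ≤ z j ∧ z j ≤ F) {j : Fin c} (hj : j ∈ S) :
    E ^ (S.card - 1) * (1 - F) ^ (c + 1 - S.card) ≤ Pprod S z j := by
  have hF' : 0 ≤ 1 - F := sub_nonneg.2 hF
  have hcard : ((S.erase j)ᶜ).card = c + 1 - S.card := by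
    have := Finset.card_pos.2 ⟨j, hj⟩
    rw [Finset.card_compl, Finset.card_erase_of_mem hj, Fintype.card_fin]
    omega
  have h1 : E ^ (S.card - 1) ≤ ∏ k ∈ S.erase j, z k := by
    rw [← Finset.card_erase_of_mem hj, ← Finset.prod_const]
    exact Finset.prod_le_prod (fun _ _ => hE) fun k _ => (hz k).1
  have h2 : (1 - F) ^ (c + 1 - S.card) ≤ ∏ k ∈ (S.erase j)ᶜ, (1 - z k) := by
    rw [← hcard, ← Finset.prod_const]
    exact Finset.prod_le_prod (fun _ _ => hF') fun k _ => by linarith [(hz k).2]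
  exact mul_le_mul h1 h2 (pow_nonneg hF' _) ((pow_nonneg hE _).trans h1)

/-- Each logarithmic prior term is bounded below by its value at the worst exponent and argument. -/
theorem mul_log_le_sub_one_mul_log {m x t U : ℝ} (hm : 0 < m) (hmx : m ≤ x) (hx : x ≤ 1)
    (hU : 0 ≤ U) (ht : t ≤ U) : U * Real.log m ≤ (t - 1) * Real.log x := by
  have h0 : Real.log x ≤ 0 := Real.log_nonpos (hm.le.trans hmx) hx
  calc U * Real.log m ≤ U * Real.log x :=
        mul_le_mul_of_nonneg_left (Real.log_le_log hm hmx) hU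
    _ ≤ (t - 1) * Real.log x := mul_le_mul_of_nonpos_right (by linarith) h0

/-- **Boundedness of the MAP loss** (Appendix A.5).
With `U₋ = a·exp(−A/γ)+b`, `U₊ = a·exp(A/γ)+b`, `B = U₋/(c·U₊ + c)`, `E = U₋/(2·U₊+1)`,
`F = (U₊+1)/(U₊+U₋+1)`, a nonempty candidate set `S`, `B ≤ θ_j ≤ 1`, `E ≤ z_j ≤ F`,
and `λ_j, α_j, β_j ≤ U₊`, we have
`L_MAP(θ,z) ≤ −log(|S|·B·E^{|S|−1}·(1−F)^{c+1−|S|}) − c·U₊·log(B·E·(1−F))`. -/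
theorem statement8 (hc : 1 ≤ c) (a b γ A : ℝ)
    (ha : 1 ≤ a) (hb : 0 ≤ b) (hγ : 0 < γ) (hA : 0 < A)
    (Um Up B E F : ℝ)
    (hUm : Um = a * Real.exp (-A / γ) + b) (hUp : Up = a * Real.exp (A / γ) + b)
    (hB : B = Um / ((c : ℝ) * Up + c)) (hE : E = Um / (2 * Up + 1))
    (hF : F = (Up + 1) / (Up + Um + 1))
    (S : Finset (Fin c)) (hS : S.Nonempty)
    (θ z lam al be : Fin c → ℝ)
    (hθ : ∀ j, B ≤ θ j ∧ θ j ≤ 1) (hz : ∀ j, E ≤ z j ∧ z j ≤ F)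
    (hlam : ∀ j, lam j ≤ Up) (hal : ∀ j, al j ≤ Up) (hbe : ∀ j, be j ≤ Up) :
    Lmap S lam al be θ z ≤
      -Real.log ((S.card : ℝ) * B * E ^ (S.card - 1) * (1 - F) ^ (c + 1 - S.card)) -
        (c : ℝ) * Up * Real.log (B * E * (1 - F)) := by
  have hUm0 : 0 < Um := by rw [hUm]; positivity
  have hUp0 : 0 < Up := by rw [hUp]; positivity
  have hc0 : (0 : ℝ) < c := by exact_mod_cast hc
  have hB0 : 0 < B := by rw [hB]; positivity
  have hE0 : 0 < E := by rw [hE]; positivity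
  have hF1 : F < 1 := by rw [hF, div_lt_one (by positivity)]; linarith
  have hF0 : 0 < 1 - F := sub_pos.2 hF1
  have hcard : (0 : ℝ) < S.card := by exact_mod_cast hS.card_pos
  have hsum : (S.card : ℝ) * B * E ^ (S.card - 1) * (1 - F) ^ (c + 1 - S.card) ≤
      ∑ j ∈ S, θ j * Pprod S z j := by
    rw [mul_assoc, mul_assoc, ← nsmul_eq_mul]
    exact Finset.card_nsmul_le_sum _ _ _ fun j hj =>
      mul_le_mul (hθ j).1 (le_Pprod hE0.le hF1.le hz hj) (by positivity)
        (hB0.le.trans (hθ j).1)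
  have hlog := Real.log_le_log (by positivity) hsum
  have hprior : (c : ℝ) * Up * Real.log (B * E * (1 - F)) ≤
      ∑ j : Fin c, ((lam j - 1) * Real.log (θ j) + (al j - 1) * Real.log (z j) +
        (be j - 1) * Real.log (1 - z j)) := by
    have hconst : (c : ℝ) * Up * Real.log (B * E * (1 - F)) =
        ∑ _j : Fin c, (Up * Real.log B + Up * Real.log E + Up * Real.log (1 - F)) := by
      rw [Real.log_mul (by positivity) hF0.ne', Real.log_mul hB0.ne' hE0.ne']
      simp only [Finset.sum_const, Finset.card_univ, Fintype.card_fin, nsmul_eq_mul]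
      ring
    rw [hconst]
    refine Finset.sum_le_sum fun j _ => ?_
    have hzE := (hz j).1
    have hzF := (hz j).2
    exact add_le_add (add_le_add
      (mul_log_le_sub_one_mul_log hB0 (hθ j).1 (hθ j).2 hUp0.le (hlam j))
      (mul_log_le_sub_one_mul_log hE0 hzE (by linarith) hUp0.le (hal j)))
      (mul_log_le_sub_one_mul_log hF0 (by linarith) (by linarith) hUp0.le (hbe j))
  unfold Lmap
  linarith
end
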